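/- There exist constants c > 0 and n_0 such that for all n ≥ n_0, if G is a uniformly random acyclic directed mixed graph (ADMG) on n labeled vertices, then E[|MEC(G)|] ≥ 2^{c·n^2}. -/

import Mathlib

namespace CausalMEC

/-- A directed graph on `Fin n`, given by a Boolean edge function (`d a b = true` means `a → b`). -/
abbrev Dir (n : ℕ) := Fin n → Fin n → Bool

/-- Directed reachability (zero or more steps). -/
def Reach {n : ℕ} (d : Dir n) : Fin n → Fin n → Prop :=
  Relation.ReflTransGen fun a b => d a b = true

/-- No directed cycles (including no self-loops). -/
def Acyclic {n : ℕ} (d : Dir n) : Prop :=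
  ∀ v, ¬ Relation.TransGen (fun a b => d a b = true) v v

/-- A directed acyclic graph. -/
def IsDAG {n : ℕ} (d : Dir n) : Prop :=
  (∀ v, d v v = false) ∧ Acyclic d

/-- A directed (possibly cyclic) graph with edges between distinct vertices. -/
def IsDCG {n : ℕ} (d : Dir n) : Prop :=
  ∀ v, d v v = false

/-- The number of directed edges. -/
def edgeCount {n : ℕ} (d : Dir n) : ℕ :=
  (Finset.univ.filter fun q : Fin n × Fin n => d q.1 q.2 = true).card

/-- The parent set of a vertex. -/
def parents {n : ℕ} (d : Dir n) (v : Fin n) : Finset (Fin n) :=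
  Finset.univ.filter fun u => d u v = true

/-! ### Paths, d-connection and Markov equivalence in mixed graphs
A mixed graph is given by a directed part `d` and a bidirected part `b`. -/

/-- The kind of a step on a path: a directed edge traversed forwards, a directed edge
traversed backwards, or a bidirected edge. -/
inductive EdgeKind : Type
  | fwd | bwd | bidir
deriving DecidableEq

/-- Does the step point into its second endpoint? -/
def EdgeKind.intoSnd : EdgeKind → Bool
  | .fwd => true
  | .bwd => false
  | .bidir => true

/-- Does the step point into its first endpoint? -/
def EdgeKind.intoFst : EdgeKind → Bool
  | .fwd => false
  | .bwd => true
  | .bidir => true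

/-- A (possibly self-intersecting) path from `u` to `v` in the mixed graph `(d, b)`. -/
structure MPath {n : ℕ} (d b : Dir n) (u v : Fin n) where
  len : ℕ
  vert : Fin (len + 1) → Fin n
  kind : Fin len → EdgeKind
  first_eq : vert 0 = u
  last_eq : vert (Fin.last len) = v
  valid : ∀ i : Fin len,
    (kind i = .fwd → d (vert i.castSucc) (vert i.succ) = true) ∧
    (kind i = .bwd → d (vert i.succ) (vert i.castSucc) = true) ∧
    (kind i = .bidir → b (vert i.castSucc) (vert i.succ) = true)

/-- Whether the internal vertex at position `i` of a path is a collider. -/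
def MPath.colliderAt {n : ℕ} {d b : Dir n} {u v : Fin n} (π : MPath d b u v)
    (i : ℕ) (h1 : 0 < i) (h2 : i < π.len) : Bool :=
  (π.kind ⟨i - 1, by omega⟩).intoSnd && (π.kind ⟨i, h2⟩).intoFst

/-- A path is active given a conditioning set `Z` if every non-collider on it avoids `Z`
and every collider on it is in `Z` or has a descendant in `Z`. -/
def MPath.Active {n : ℕ} {d b : Dir n} {u v : Fin n} (π : MPath d b u v)
    (Z : Finset (Fin n)) : Prop :=
  ∀ (i : ℕ) (h1 : 0 < i) (h2 : i < π.len),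
    (π.colliderAt i h1 h2 = true →
      ∃ x ∈ Z, Reach d (π.vert ⟨i, by omega⟩) x) ∧
    (π.colliderAt i h1 h2 = false →
      π.vert ⟨i, by omega⟩ ∉ Z)

/-- d-connection given a conditioning set. -/
def DConn {n : ℕ} (d b : Dir n) (u v : Fin n) (Z : Finset (Fin n)) : Prop :=
  ∃ π : MPath d b u v, π.Active Z

/-- Markov equivalence of two mixed graphs: the same d-connection relations. -/
def MarkovEquiv {n : ℕ} (d b d' b' : Dir n) : Prop :=
  ∀ (u v : Fin n) (Z : Finset (Fin n)), u ≠ v → u ∉ Z → v ∉ Z →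
    (DConn d b u v Z ↔ DConn d' b' u v Z)

/-- The empty bidirected part: a purely directed graph. -/
def noBi (n : ℕ) : Dir n := fun _ _ => false

/-- Markov equivalence for purely directed graphs. -/
def MarkovEquivD {n : ℕ} (d d' : Dir n) : Prop :=
  MarkovEquiv d (noBi n) d' (noBi n)

/-- The Markov equivalence class of a DAG (within DAGs). -/
def MECdag {n : ℕ} (d : Dir n) : Set (Dir n) :=
  {d' | IsDAG d' ∧ MarkovEquivD d d'}

/-- An acyclic directed mixed graph. -/
def IsADMG {n : ℕ} (d b : Dir n) : Prop :=
  IsDAG d ∧ (∀ v w, b v w = b w v) ∧ (∀ v, b v v = false)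

/-- The Markov equivalence class of an ADMG (within ADMGs). -/
def MECadmg {n : ℕ} (d b : Dir n) : Set (Dir n × Dir n) :=
  {G | IsADMG G.1 G.2 ∧ MarkovEquiv d b G.1 G.2}

/-- The Markov equivalence class of a DCG (within DCGs). -/
def MECdcg {n : ℕ} (d : Dir n) : Set (Dir n) :=
  {d' | IsDCG d' ∧ MarkovEquivD d d'}

/-! ### The distribution `D(n,p)` and uniform ADMGs/DCGs -/

/-- The (unnormalized) weight of a DAG under `D(n,p)`. -/
noncomputable def dagWeight {n : ℕ} (p : ℝ) (d : Dir n) : ℝ :=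
  (p / (1 - p)) ^ edgeCount d

open scoped Classical in
/-- Probability of the event `A` under `D(n,p)`. -/
noncomputable def prD (n : ℕ) (p : ℝ) (A : Dir n → Prop) : ℝ :=
  (∑ d : Dir n, if IsDAG d ∧ A d then dagWeight p d else 0) /
    (∑ d : Dir n, if IsDAG d then dagWeight p d else 0)

open scoped Classical in
/-- Expectation of `f` under `D(n,p)`. -/
noncomputable def expD (n : ℕ) (p : ℝ) (f : Dir n → ℝ) : ℝ :=
  (∑ d : Dir n, if IsDAG d then f d * dagWeight p d else 0) /
    (∑ d : Dir n, if IsDAG d then dagWeight p d else 0)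

/-- Conditional probability of `A` given `B` under `D(n,p)`. -/
noncomputable def condPrD (n : ℕ) (p : ℝ) (A B : Dir n → Prop) : ℝ :=
  prD n p (fun d => A d ∧ B d) / prD n p B

open scoped Classical in
/-- Expectation of `f` under the uniform distribution on ADMGs on `n` vertices. -/
noncomputable def expADMG (n : ℕ) (f : Dir n × Dir n → ℝ) : ℝ :=
  (∑ G : Dir n × Dir n, if IsADMG G.1 G.2 then f G else 0) /
    (∑ G : Dir n × Dir n, if IsADMG G.1 G.2 then (1 : ℝ) else 0)

open scoped Classical in
/-- Expectation of `f` under the uniform distribution on DCGs on `n` vertices. -/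
noncomputable def expDCG (n : ℕ) (f : Dir n → ℝ) : ℝ :=
  (∑ d : Dir n, if IsDCG d then f d else 0) /
    (∑ d : Dir n, if IsDCG d then (1 : ℝ) else 0)

open scoped Classical in
/-- Probability of the event `A` under the uniform distribution on DCGs on `n` vertices. -/
noncomputable def prDCG (n : ℕ) (A : Dir n → Prop) : ℝ :=
  (∑ d : Dir n, if IsDCG d ∧ A d then (1 : ℝ) else 0) /
    (∑ d : Dir n, if IsDCG d then (1 : ℝ) else 0)

/-! ### Tower decomposition -/

/-- The sources of `d` within a vertex set `S` (no parents inside `S`). -/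
def sourcesIn {n : ℕ} (d : Dir n) (S : Finset (Fin n)) : Finset (Fin n) :=
  S.filter fun v => ∀ u ∈ S, d u v = false

/-- The vertices remaining after peeling off `k` layers of sources. -/
def remaining {n : ℕ} (d : Dir n) : ℕ → Finset (Fin n)
  | 0 => Finset.univ
  | k + 1 => remaining d k \ sourcesIn d (remaining d k)

/-- The `i`-th layer (1-based) of the tower decomposition of `d`. -/
def towerLayer {n : ℕ} (d : Dir n) (i : ℕ) : Finset (Fin n) :=
  sourcesIn d (remaining d (i - 1))

/-- The 1-based index of the layer containing `v`. -/
def layerIdx {n : ℕ} (d : Dir n) (v : Fin n) : ℕ :=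
  ((Finset.range n).filter fun j => v ∈ remaining d j).card

/-- The tower of a DAG: only the edges between adjacent layers are kept. -/
def tower {n : ℕ} (d : Dir n) : Dir n :=
  fun a c => d a c && decide (layerIdx d c = layerIdx d a + 1)

/-- `h` is the tower vector of `d` (layer sizes, 1-based, and no further layers). -/
def hasTowerVector {n : ℕ} (d : Dir n) (h : List ℕ) : Prop :=
  (∀ i : Fin h.length, (towerLayer d (i.val + 1)).card = h.get i) ∧
    towerLayer d (h.length + 1) = ∅

/-- `H` is the tower decomposition of `d`. -/
def hasTowerDecomp {n : ℕ} (d : Dir n) (H : List (Finset (Fin n))) : Prop :=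
  (∀ i : Fin H.length, towerLayer d (i.val + 1) = H.get i) ∧
    towerLayer d (H.length + 1) = ∅

/-- The weight `w(h)` of a tower vector `h = (h_1, …, h_s)`. -/
noncomputable def towerWeight (p : ℝ) (h : List ℕ) : ℝ :=
  (Nat.multinomial Finset.univ (fun i : Fin h.length => h.get i) : ℝ) *
    ∏ k ∈ Finset.Icc 2 h.length,
      (1 - (1 - p) ^ h.getD (k - 2) 0) ^ h.getD (k - 1) 0 /
        (1 - p) ^ (h.getD (k - 1) 0 * ∑ i ∈ Finset.range (k - 1), h.getD i 0)

/-! ### Edge reversal and deletion -/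

/-- Reverse the edge `v → w`. -/
def reverseEdge {n : ℕ} (d : Dir n) (v w : Fin n) : Dir n :=
  fun a c => if a = v ∧ c = w then false else if a = w ∧ c = v then true else d a c

/-- Delete the edge `v → w`. -/
def deleteEdge {n : ℕ} (d : Dir n) (v w : Fin n) : Dir n :=
  fun a c => if a = v ∧ c = w then false else d a c

/-- The edge `v → w` of a DAG is reversible: reversing it yields a Markov-equivalent DAG. -/
def Reversible {n : ℕ} (d : Dir n) (v w : Fin n) : Prop :=
  d v w = true ∧ IsDAG (reverseEdge d v w) ∧ MarkovEquivD d (reverseEdge d v w)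

/-- `d` has a matching of reversible layer-2-edges of size at least `m`. -/
def hasRevL2Matching {n : ℕ} (d : Dir n) (m : ℝ) : Prop :=
  ∃ S : Finset (Fin n × Fin n),
    (∀ e ∈ S, Reversible d e.1 e.2 ∧ e.2 ∈ towerLayer d 2) ∧
    (∀ e ∈ S, ∀ e' ∈ S, e ≠ e' →
      e.1 ≠ e'.1 ∧ e.1 ≠ e'.2 ∧ e.2 ≠ e'.1 ∧ e.2 ≠ e'.2) ∧
    m ≤ (S.card : ℝ)

/-! ### Cycles and the `Reverse` construction -/

/-- Cyclic successor in `Fin k`. -/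
def cycSucc {k : ℕ} (i : Fin k) : Fin k :=
  ⟨(i.val + 1) % k, Nat.mod_lt _ i.pos⟩

/-- The reversed parametrization of a cycle. -/
def cycRev {n k : ℕ} (c : Fin k → Fin n) : Fin k → Fin n :=
  fun i => c ⟨(k - i.val) % k, Nat.mod_lt _ i.pos⟩

/-- `c` lists the (distinct) vertices of a directed cycle of `d`, in order. -/
def IsCycle {n k : ℕ} (d : Dir n) (c : Fin k → Fin n) : Prop :=
  Function.Injective c ∧ ∀ i, d (c i) (c (cycSucc i)) = true

/-- The `Reverse(G, C)` construction: reverse the cycle `c` and redirect every edge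
`w → v_i` with `w ∈ Pa(v_i) \ {v_{i-1}}` to `w → v_{i-1}`. -/
def reverseCycle {n k : ℕ} (d : Dir n) (c : Fin k → Fin n) : Dir n :=
  fun a e =>
    decide ((∃ j : Fin k, e = c j ∧
        (a = c (cycSucc j) ∨ (d a (c (cycSucc j)) = true ∧ a ≠ c j))) ∨
      ((∀ j : Fin k, e ≠ c j) ∧ d a e = true))

/-- A vertex triple induces exactly a directed 3-cycle. -/
def induces3Cycle {n : ℕ} (d : Dir n) (W : Finset (Fin n)) : Prop :=
  ∃ a b c : Fin n, W = {a, b, c} ∧ a ≠ b ∧ a ≠ c ∧ b ≠ c ∧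
    d a b = true ∧ d b c = true ∧ d c a = true ∧
    d b a = false ∧ d c b = false ∧ d a c = false

/-- Unordered pairs of distinct vertices. -/
abbrev VertexPair (n : ℕ) := {e : Sym2 (Fin n) // ¬ e.IsDiag}

/-- The unordered pair of two distinct vertices. -/
def VertexPair.mk {n : ℕ} (a c : Fin n) (h : a ≠ c) : VertexPair n := ⟨s(a, c), h⟩

theorem VertexPair.mk_comm {n : ℕ} (a c : Fin n) (h : a ≠ c) :
    VertexPair.mk a c h = VertexPair.mk c a h.symm :=
  Subtype.ext Sym2.eq_swap

theorem VertexPair.card (n : ℕ) : Fintype.card (VertexPair n) = n.choose 2 := by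
  simpa using Sym2.card_subtype_not_diag (α := Fin n)

/-- A set of unordered pairs, oriented along a rank function. -/
def orient {n : ℕ} {α : Type*} [LinearOrder α] (r : Fin n → α) (f : VertexPair n → Bool) : Dir n :=
  fun a c => if h : a ≠ c then decide (r a < r c) && f (VertexPair.mk a c h) else false

/-- A set of unordered pairs as a symmetric relation. -/
def symmetrize {n : ℕ} (f : VertexPair n → Bool) : Dir n :=
  fun a c => if h : a ≠ c then f (VertexPair.mk a c h) else false

theorem orient_of_lt {n : ℕ} {α : Type*} [LinearOrder α] (r : Fin n → α)
    (f : VertexPair n → Bool) {a c : Fin n} (h : a ≠ c) (hr : r a < r c) :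
    orient r f a c = f (VertexPair.mk a c h) := by
  simp [orient, h, hr]

theorem symmetrize_of_ne {n : ℕ} (f : VertexPair n → Bool) {a c : Fin n} (h : a ≠ c) :
    symmetrize f a c = f (VertexPair.mk a c h) := by
  simp [symmetrize, h]

theorem isDAG_orient {n : ℕ} {α : Type*} [LinearOrder α] (r : Fin n → α)
    (f : VertexPair n → Bool) : IsDAG (orient r f) := by
  refine ⟨fun v => by simp [orient], fun v hv => ?_⟩
  have key : ∀ a c, Relation.TransGen (fun a c => orient r f a c = true) a c → r a < r c := by
    have step : ∀ a c, orient r f a c = true → r a < r c := by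
      intro a c h
      by_cases hac : a = c <;> simp_all [orient]
    intro a c h
    induction h with
    | single h => exact step _ _ h
    | tail _ h ih => exact ih.trans (step _ _ h)
  exact lt_irrefl _ (key v v hv)

theorem isADMG_orient_symmetrize {n : ℕ} {α : Type*} [LinearOrder α] (r : Fin n → α)
    (f g : VertexPair n → Bool) : IsADMG (orient r f) (symmetrize g) := by
  refine ⟨isDAG_orient r f, fun v w => ?_, fun v => by simp [symmetrize]⟩
  by_cases h : v = w
  · rw [h]
  · rw [symmetrize_of_ne g h, symmetrize_of_ne g (Ne.symm h), VertexPair.mk_comm]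

theorem exists_symmetrize_eq {n : ℕ} {b : Dir n} (hs : ∀ v w, b v w = b w v)
    (hd : ∀ v, b v v = false) : ∃ g, symmetrize g = b := by
  refine ⟨fun e => Sym2.lift ⟨b, hs⟩ e.1, ?_⟩
  funext a c
  by_cases h : a = c
  · subst h; simp [symmetrize, hd]
  · simp [symmetrize_of_ne _ h, VertexPair.mk]

theorem IsDAG.exists_rank {n : ℕ} {d : Dir n} (hd : IsDAG d) :
    ∃ r : Fin n → Fin n, ∀ a c, d a c = true → r a < r c := by
  classical
  let anc : Fin n → Finset (Fin n) := fun v =>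
    Finset.univ.filter fun u => Relation.TransGen (fun a b => d a b = true) u v
  have hself : ∀ v, v ∉ anc v := fun v => by simpa [anc] using hd.2 v
  refine ⟨fun v => ⟨(anc v).card, ?_⟩, fun a c hac => ?_⟩
  · simpa using Finset.card_lt_univ_of_notMem (hself v)
  · rw [Fin.mk_lt_mk]
    refine Finset.card_lt_card ⟨fun u hu => ?_, fun hsub => hself a (hsub ?_)⟩
    · simp only [anc, Finset.mem_filter, Finset.mem_univ, true_and] at hu ⊢
      exact hu.tail hac
    · exact Finset.mem_filter.2 ⟨Finset.mem_univ _, .single hac⟩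

theorem IsDAG.exists_orient_eq {n : ℕ} {d : Dir n} (hd : IsDAG d) :
    ∃ (r : Fin n → Fin n) (f : VertexPair n → Bool), orient r f = d := by
  obtain ⟨r, hr⟩ := hd.exists_rank
  refine ⟨r, fun e => Sym2.lift ⟨fun a c => d a c || d c a, fun a c => Bool.or_comm _ _⟩ e.1, ?_⟩
  funext a c
  by_cases h : a = c
  · subst h; simp [orient, hd.1]
  by_cases hlt : r a < r c
  · have hca : d c a = false := by
      by_contra hca
      exact lt_asymm hlt (hr c a (by simpa using hca))
    simp [orient_of_lt r _ h hlt, VertexPair.mk, hca]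
  · have hac : d a c = false := by
      by_contra hac
      exact hlt (hr a c (by simpa using hac))
    simp [orient, hlt, hac]

open scoped Classical in
theorem card_isADMG_le (n : ℕ) :
    (Finset.univ.filter fun G : Dir n × Dir n => IsADMG G.1 G.2).card ≤
      n ^ n * 4 ^ n.choose 2 := by
  let F : (Fin n → Fin n) × (VertexPair n → Bool) × (VertexPair n → Bool) → Dir n × Dir n :=
    fun x => (orient x.1 x.2.1, symmetrize x.2.2)
  have hsub : (Finset.univ.filter fun G : Dir n × Dir n => IsADMG G.1 G.2) ⊆
      Finset.univ.image F := by
    rintro ⟨d, b⟩ hG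
    obtain ⟨hd, hs, hb⟩ := (Finset.mem_filter.1 hG).2
    obtain ⟨r, f, hf⟩ := hd.exists_orient_eq
    obtain ⟨g, hg⟩ := exists_symmetrize_eq hs hb
    exact Finset.mem_image.2 ⟨(r, f, g), Finset.mem_univ _, Prod.ext hf hg⟩
  refine (Finset.card_le_card hsub).trans (Finset.card_image_le.trans (le_of_eq ?_))
  rw [Finset.card_univ, Fintype.card_prod, Fintype.card_prod, Fintype.card_fun, Fintype.card_fun,
    VertexPair.card, Fintype.card_fin, Fintype.card_bool, ← mul_pow,
    show 2 * 2 = 4 from rfl]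

/-- Every two distinct vertices are joined by an edge. -/
def AllAdjacent {n : ℕ} (d b : Dir n) : Prop :=
  ∀ u v : Fin n, u ≠ v → d u v = true ∨ d v u = true ∨ b u v = true

theorem dConn_of_edge {n : ℕ} {d b : Dir n} {u v : Fin n} (k : EdgeKind)
    (h : (k = .fwd → d u v = true) ∧ (k = .bwd → d v u = true) ∧ (k = .bidir → b u v = true))
    (Z : Finset (Fin n)) : DConn d b u v Z := by
  refine ⟨⟨1, ![u, v], fun _ => k, rfl, rfl, fun i => ?_⟩, fun i h1 h2 => ?_⟩
  · obtain rfl : i = 0 := Subsingleton.elim _ _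
    exact h
  · have : i < 1 := h2
    omega

theorem AllAdjacent.dConn {n : ℕ} {d b : Dir n} (h : AllAdjacent d b) {u v : Fin n} (huv : u ≠ v)
    (Z : Finset (Fin n)) : DConn d b u v Z := by
  rcases h u v huv with h | h | h
  · exact dConn_of_edge .fwd (by simp [h]) Z
  · exact dConn_of_edge .bwd (by simp [h]) Z
  · exact dConn_of_edge .bidir (by simp [h]) Z

theorem AllAdjacent.markovEquiv {n : ℕ} {d b d' b' : Dir n} (h : AllAdjacent d b)
    (h' : AllAdjacent d' b') : MarkovEquiv d b d' b' :=
  fun _ _ Z huv _ _ => iff_of_true (h.dConn huv Z) (h'.dConn huv Z)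

open scoped Classical in
theorem le_card_allAdjacent (n : ℕ) :
    3 ^ n.choose 2 ≤
      (Finset.univ.filter fun G : Dir n × Dir n => IsADMG G.1 G.2 ∧ AllAdjacent G.1 G.2).card := by
  let F : (VertexPair n → Fin 3) → Dir n × Dir n :=
    fun t => (orient id fun e => decide (t e ≠ 0), symmetrize fun e => decide (t e ≠ 1))
  have hADMG : ∀ t, IsADMG (F t).1 (F t).2 := fun t =>
    isADMG_orient_symmetrize (id : Fin n → Fin n) (fun e => decide (t e ≠ 0))
      fun e => decide (t e ≠ 1)
  have hF : ∀ t (a c : Fin n) (h : a < c), (F t).1 a c = decide (t (VertexPair.mk a c h.ne) ≠ 0) ∧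
      (F t).2 a c = decide (t (VertexPair.mk a c h.ne) ≠ 1) := fun t a c h =>
    ⟨orient_of_lt id (fun e => decide (t e ≠ 0)) h.ne h,
      symmetrize_of_ne (fun e => decide (t e ≠ 1)) h.ne⟩
  have hinj : Function.Injective F := by
    intro t t' htt
    have hlt : ∀ (a c : Fin n) (h : a < c),
        t (VertexPair.mk a c h.ne) = t' (VertexPair.mk a c h.ne) := by
      intro a c h
      have h1 := hF t a c h
      have h2 := hF t' a c h
      rw [htt] at h1
      have e0 := h1.1.symm.trans h2.1
      have e1 := h1.2.symm.trans h2.2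
      revert e0 e1
      generalize t (VertexPair.mk a c h.ne) = x
      generalize t' (VertexPair.mk a c h.ne) = y
      revert x y
      decide
    funext ⟨e, he⟩
    induction e using Sym2.ind with
    | _ a c =>
      rcases lt_or_gt_of_ne (show a ≠ c from he) with h | h
      · exact hlt a c h
      · have := hlt c a h
        rwa [VertexPair.mk_comm] at this
  have hadj : ∀ t, AllAdjacent (F t).1 (F t).2 := by
    have key : ∀ t (a c : Fin n), a < c → (F t).1 a c = true ∨ (F t).2 a c = true := by
      intro t a c h
      rw [(hF t a c h).1, (hF t a c h).2]
      generalize t (VertexPair.mk a c h.ne) = x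
      revert x
      decide
    intro t u v huv
    rcases lt_or_gt_of_ne huv with h | h
    · exact (key t u v h).imp_right Or.inr
    · refine Or.inr ((key t v u h).imp_right fun h' => ?_)
      rwa [(hADMG t).2.1] at h'
  calc 3 ^ n.choose 2 = (Finset.univ.image F).card := by
        rw [Finset.card_image_of_injective _ hinj, Finset.card_univ, Fintype.card_fun,
          VertexPair.card, Fintype.card_fin]
    _ ≤ _ := Finset.card_le_card fun G hG => by
        obtain ⟨t, -, rfl⟩ := Finset.mem_image.1 hG
        exact Finset.mem_filter.2 ⟨Finset.mem_univ _, hADMG t, hadj t⟩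

open scoped Classical in
/-- The fully adjacent ADMGs all lie in one Markov equivalence class, so they alone contribute the
square of their number to the sum of all class sizes. -/
theorem nine_pow_le_sum_ncard (n : ℕ) :
    (9 : ℝ) ^ n.choose 2 ≤ ∑ G : Dir n × Dir n,
      if IsADMG G.1 G.2 then ((MECadmg G.1 G.2).ncard : ℝ) else 0 := by
  set A := Finset.univ.filter fun G : Dir n × Dir n => IsADMG G.1 G.2 ∧ AllAdjacent G.1 G.2 with hA
  have hcard : (3 : ℝ) ^ n.choose 2 ≤ A.card := mod_cast le_card_allAdjacent n
  have hclass : ∀ G ∈ A, (A.card : ℝ) ≤ (MECadmg G.1 G.2).ncard := by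
    intro G hG
    rw [← Set.ncard_coe_finset A]
    refine Nat.cast_le.2 (Set.ncard_le_ncard (fun G' hG' => ?_) (Set.toFinite _))
    have h' := (Finset.mem_filter.1 (Finset.mem_coe.1 hG')).2
    exact ⟨h'.1, (Finset.mem_filter.1 hG).2.2.markovEquiv h'.2⟩
  calc (9 : ℝ) ^ n.choose 2 = 3 ^ n.choose 2 * 3 ^ n.choose 2 := by rw [← mul_pow]; norm_num
    _ ≤ A.card * A.card := by gcongr
    _ = ∑ G ∈ A, (A.card : ℝ) := by simp
    _ ≤ ∑ G ∈ A, if IsADMG G.1 G.2 then ((MECadmg G.1 G.2).ncard : ℝ) else 0 :=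
        Finset.sum_le_sum fun G hG => by
          rw [if_pos (Finset.mem_filter.1 hG).2.1]
          exact hclass G hG
    _ ≤ _ := Finset.sum_le_sum_of_subset_of_nonneg (Finset.subset_univ _) fun G _ _ => by
        positivity

theorem pow_eight_le_two_pow {n : ℕ} (hn : 44 ≤ n) : n ^ 8 ≤ 2 ^ n := by
  induction n, hn using Nat.le_induction with
  | base => norm_num
  | succ n hn ih =>
    have hstep : (n + 1) ^ 8 ≤ 2 * n ^ 8 := by
      have h : 44 * (n + 1) ≤ 45 * n := by omega
      have h8 := Nat.pow_le_pow_left h 8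
      rw [mul_pow, mul_pow] at h8
      norm_num at h8
      omega
    rw [pow_succ 2]
    omega

/-- Theorem 1.2(a): there are `c > 0` and `n₀` such that for all `n ≥ n₀`,
the expected size of the Markov equivalence class of a uniformly random ADMG on `n`
vertices is at least `2 ^ (c·n²)`. -/
theorem admg_mec_lower_bound :
    ∃ c : ℝ, 0 < c ∧ ∃ n₀ : ℕ, ∀ n ≥ n₀,
      (2 : ℝ) ^ (c * (n : ℝ) ^ 2) ≤
        expADMG n fun G => ((MECadmg G.1 G.2).ncard : ℝ) := by
  classical
  refine ⟨1 / 8, by norm_num, 44, fun n hn => ?_⟩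
  have hn' : (44 : ℝ) ≤ n := mod_cast hn
  have hself : (n : ℝ) ^ n ≤ 2 ^ (1 / 8 * (n : ℝ) ^ 2) := by
    have h : (n : ℝ) ≤ 2 ^ (1 / 8 * (n : ℝ)) := by
      refine le_of_pow_le_pow_left₀ (n := 8) (by norm_num) (by positivity) ?_
      rw [← Real.rpow_mul_natCast (by norm_num)]
      have h8 : (n : ℝ) ^ 8 ≤ 2 ^ n := mod_cast pow_eight_le_two_pow hn
      refine h8.trans (le_of_eq ?_)
      rw [← Real.rpow_natCast]
      congr 1
      push_cast
      ring
    calc (n : ℝ) ^ n ≤ (2 ^ (1 / 8 * (n : ℝ))) ^ n := by gcongr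
      _ = 2 ^ (1 / 8 * (n : ℝ) ^ 2) := by
        rw [← Real.rpow_mul_natCast (by norm_num)]
        congr 1
        ring
  have hpairs : (2 : ℝ) ^ (1 / 8 * (n : ℝ) ^ 2) * 2 ^ (1 / 8 * (n : ℝ) ^ 2) ≤ 2 ^ n.choose 2 := by
    rw [← Real.rpow_add (by norm_num), ← Real.rpow_natCast 2 (n.choose 2),
      Nat.cast_choose_two]
    exact Real.rpow_le_rpow_of_exponent_le (by norm_num) (by nlinarith)
  have hcount : (∑ G : Dir n × Dir n, if IsADMG G.1 G.2 then (1 : ℝ) else 0) ≤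
      n ^ n * 4 ^ n.choose 2 := by
    rw [Finset.sum_boole]
    exact_mod_cast card_isADMG_le n
  have hpos : 0 < ∑ G : Dir n × Dir n, if IsADMG G.1 G.2 then (1 : ℝ) else 0 := by
    rw [Finset.sum_boole, Nat.cast_pos, Finset.card_pos]
    exact ⟨(orient id fun _ => false, symmetrize fun _ => false), Finset.mem_filter.2
      ⟨Finset.mem_univ _, isADMG_orient_symmetrize (id : Fin n → Fin n) (fun _ => false)
        fun _ => false⟩⟩
  rw [expADMG, le_div_iff₀ hpos]
  calc (2 : ℝ) ^ (1 / 8 * (n : ℝ) ^ 2) * _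
      ≤ 2 ^ (1 / 8 * (n : ℝ) ^ 2) * (2 ^ (1 / 8 * (n : ℝ) ^ 2) * 4 ^ n.choose 2) := by
        gcongr
        exact hcount.trans (by gcongr)
    _ ≤ 2 ^ n.choose 2 * 4 ^ n.choose 2 := by
        rw [← mul_assoc]
        gcongr
    _ ≤ 9 ^ n.choose 2 := by
        rw [← mul_pow]
        gcongr
        norm_num
    _ ≤ _ := nine_pow_le_sum_ncard n

end CausalMEC
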